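/- arXiv:2507.09093 — 5 statements merged into one kernel-verified Lean document; each statement's English description precedes it below -/
import Mathlib

section
/- Let φ : ℝ → ℝ be twice continuously differentiable, odd, and nondecreasing, with φ′(0) ≥ c for some c > 0 and |φ″(y)| ≤ K for all y ∈ ℝ, where K > 0. Then for every y ∈ ℝ, y·φ(y) ≥ min{ (c²/(4K))·|y|, (c/2)·y² }. -/
/-- A second-order Taylor lower bound at `0` under a one-sided bound on the second derivative. -/
theorem taylor_lower_bound_of_neg_le_deriv2 {f : ℝ → ℝ} {K : ℝ} (hf : ContDiff ℝ 2 f)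
    (hK : ∀ y, -K ≤ deriv (deriv f) y) {y : ℝ} (hy : 0 ≤ y) :
    f 0 + deriv f 0 * y - K / 2 * y ^ 2 ≤ f y := by
  have hf₁ : Differentiable ℝ f := hf.differentiable (by norm_num)
  have hf₂ : Differentiable ℝ (deriv f) :=
    (contDiff_succ_iff_deriv (n := 1).mp hf).2.2.differentiable one_ne_zero
  have hderiv_mono : Monotone fun x => deriv f x + K * x := by
    have h : ∀ x, HasDerivAt (fun x => deriv f x + K * x) (deriv (deriv f) x + K * 1) x :=
      fun x => (hf₂ x).hasDerivAt.add ((hasDerivAt_id x).const_mul K)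
    refine monotone_of_deriv_nonneg (fun x => (h x).differentiableAt) fun x => ?_
    rw [(h x).deriv]
    linarith [hK x]
  have h : ∀ x, HasDerivAt (fun x => f x - deriv f 0 * x + K / 2 * x ^ 2)
      (deriv f x - deriv f 0 + K * x) x := fun x => by
    refine (((hf₁ x).hasDerivAt.sub ((hasDerivAt_id x).const_mul (deriv f 0))).add
      ((hasDerivAt_pow 2 x).const_mul (K / 2))).congr_deriv ?_
    push_cast
    ring
  have hmono : MonotoneOn (fun x => f x - deriv f 0 * x + K / 2 * x ^ 2) (Set.Ici 0) := by
    refine monotoneOn_of_deriv_nonneg (convex_Ici 0)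
      (fun x _ => (h x).continuousAt.continuousWithinAt)
      (fun x _ => (h x).differentiableAt.differentiableWithinAt) fun x hx => ?_
    rw [interior_Ici] at hx
    rw [(h x).deriv]
    have := hderiv_mono (le_of_lt hx)
    simp only [mul_zero, add_zero] at this
    linarith
  have := hmono Set.self_mem_Ici hy hy
  norm_num at this
  linarith

/-- Scalar core of the component-wise denoised-nonlinearity lemma: if `φ` is twice
continuously differentiable, odd, nondecreasing, with `φ′(0) ≥ c > 0` and `|φ″| ≤ K`,
then `y·φ(y) ≥ min {(c²/(4K))|y|, (c/2)y²}`. -/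
theorem stmt2 (φ : ℝ → ℝ) (c K : ℝ) (hc : 0 < c) (hK : 0 < K)
    (hsmooth : ContDiff ℝ 2 φ) (hodd : ∀ y, φ (-y) = -φ y)
    (hmono : Monotone φ) (hderiv0 : c ≤ deriv φ 0)
    (hK2 : ∀ y, |deriv (deriv φ) y| ≤ K) :
    ∀ y : ℝ, min (c ^ 2 / (4 * K) * |y|) (c / 2 * y ^ 2) ≤ y * φ y := by
  have hφ0 : φ 0 = 0 := by
    have := hodd 0
    rw [neg_zero] at this
    linarith
  have hlin : ∀ y, 0 ≤ y → y ≤ c / K → c / 2 * y ≤ φ y := fun y hy hyc => by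
    have htaylor := taylor_lower_bound_of_neg_le_deriv2 hsmooth
      (fun x => (abs_le.mp (hK2 x)).1) hy
    rw [le_div_iff₀ hK] at hyc
    nlinarith [mul_le_mul_of_nonneg_right hderiv0 hy, mul_le_mul_of_nonneg_left hyc hy]
  have hnonneg : ∀ y, 0 ≤ y →
      min (c ^ 2 / (4 * K) * |y|) (c / 2 * y ^ 2) ≤ y * φ y := fun y hy => by
    rcases le_total y (c / K) with hyc | hyc
    · refine (min_le_right _ _).trans ?_
      nlinarith [mul_le_mul_of_nonneg_left (hlin y hy hyc) hy]
    · refine (min_le_left _ _).trans ?_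
      rw [abs_of_nonneg hy, mul_comm]
      refine mul_le_mul_of_nonneg_left ?_ hy
      calc c ^ 2 / (4 * K) ≤ c ^ 2 / (2 * K) := by gcongr; norm_num
        _ = c / 2 * (c / K) := by field_simp
        _ ≤ φ (c / K) := hlin _ (by positivity) le_rfl
        _ ≤ φ y := hmono hyc
  intro y
  rcases le_total 0 y with hy | hy
  · exact hnonneg y hy
  · simpa [hodd] using hnonneg (-y) (neg_nonneg.mpr hy)
end

section
/- Let d ≥ 1, A, B ≥ 0, and for each i ∈ {1,…,d} let φᵢ : ℝ → ℝ be a function satisfying y·φᵢ(y) ≥ min{A|y|, B y²} for all y ∈ ℝ. Then for every y ∈ ℝ^d, Σ_{i=1}^d yᵢ·φᵢ(yᵢ) ≥ min{ A‖y‖/√d, B‖y‖²/d }, where ‖·‖ is the Euclidean norm. -/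
/-- Some coordinate of a Euclidean vector has square at least the mean of the squares. -/
theorem EuclideanSpace.exists_norm_sq_div_card_le_sq {ι : Type*} [Fintype ι] [Nonempty ι]
    (y : EuclideanSpace ℝ ι) : ∃ i, ‖y‖ ^ 2 / Fintype.card ι ≤ y i ^ 2 := by
  have hcard : (Fintype.card ι : ℝ) ≠ 0 := by exact_mod_cast Fintype.card_ne_zero
  have hsum : ∑ _i : ι, ‖y‖ ^ 2 / Fintype.card ι ≤ ∑ i, y i ^ 2 := by
    rw [← EuclideanSpace.real_norm_sq_eq, Finset.sum_const, Finset.card_univ, nsmul_eq_mul,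
      mul_div_cancel₀ _ hcard]
  obtain ⟨i, -, hi⟩ := Finset.exists_le_of_sum_le Finset.univ_nonempty hsum
  exact ⟨i, hi⟩

/-- Aggregation step for component-wise nonlinearities: if each scalar component satisfies
`y·φᵢ(y) ≥ min {A|y|, B y²}`, then the sum satisfies
`Σᵢ yᵢ·φᵢ(yᵢ) ≥ min {A‖y‖/√d, B‖y‖²/d}` in Euclidean norm. -/
theorem stmt3 (d : ℕ) (hd : 1 ≤ d) (A B : ℝ) (hA : 0 ≤ A) (hB : 0 ≤ B)
    (φ : Fin d → ℝ → ℝ)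
    (hφ : ∀ i : Fin d, ∀ y : ℝ, min (A * |y|) (B * y ^ 2) ≤ y * φ i y) :
    ∀ y : EuclideanSpace ℝ (Fin d),
      min (A * ‖y‖ / Real.sqrt d) (B * ‖y‖ ^ 2 / d) ≤ ∑ i, y i * φ i (y i) := by
  intro y
  have : Nonempty (Fin d) := ⟨⟨0, hd⟩⟩
  obtain ⟨i, hi⟩ := EuclideanSpace.exists_norm_sq_div_card_le_sq y
  rw [Fintype.card_fin] at hi
  have habs : ‖y‖ / √d ≤ |y i| := by
    apply abs_le_of_sq_le_sq' _ (abs_nonneg _) |>.2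
    rwa [div_pow, Real.sq_sqrt d.cast_nonneg, sq_abs]
  have hnonneg : ∀ j ∈ Finset.univ, 0 ≤ y j * φ j (y j) := fun j _ =>
    (le_min (by positivity) (by positivity)).trans (hφ j (y j))
  calc min (A * ‖y‖ / √d) (B * ‖y‖ ^ 2 / d)
      ≤ min (A * |y i|) (B * y i ^ 2) := by
        rw [mul_div_assoc, mul_div_assoc]
        gcongr
    _ ≤ y i * φ i (y i) := hφ i (y i)
    _ ≤ ∑ j, y j * φ j (y j) := Finset.single_le_sum hnonneg (Finset.mem_univ i)
end

section
/- Let φ : (0,∞) → ℝ be nonnegative and nonincreasing, and suppose a ↦ a·φ(a) is nondecreasing on (0,∞). Then for all y, z ∈ ℝ^d with ‖z‖ > ‖y‖, one has |φ(‖y+z‖) − φ(‖y−z‖)| ≤ (‖y‖/‖z‖)·(φ(‖y+z‖) + φ(‖y−z‖)). (Note ‖y±z‖ ≥ ‖z‖ − ‖y‖ > 0, so both arguments are positive.) -/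
/-- If `φ` is nonnegative and `a ↦ a * φ a` is nondecreasing on `(0,∞)`, then for
`Z - Y ≤ b ≤ a ≤ Z + Y` with `Y < Z`, the difference `φ b - φ a` is at most `Y / Z` times
the sum `φ a + φ b`. -/
theorem sub_le_div_mul_add_of_monotoneOn_mul {φ : ℝ → ℝ}
    (hnn : ∀ a : ℝ, 0 < a → 0 ≤ φ a)
    (hmono : MonotoneOn (fun a => a * φ a) (Set.Ioi 0))
    {Y Z a b : ℝ} (hZ : 0 < Z) (hYZ : Y < Z) (hb : Z - Y ≤ b) (hba : b ≤ a) (ha : a ≤ Z + Y) :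
    φ b - φ a ≤ Y / Z * (φ a + φ b) := by
  have hb0 : 0 < b := by linarith
  have ha0 : 0 < a := hb0.trans_le hba
  have hmul : b * φ b ≤ a * φ a := hmono hb0 ha0 hba
  have hlow : (Z - Y) * φ b ≤ b * φ b := mul_le_mul_of_nonneg_right hb (hnn b hb0)
  have hupp : a * φ a ≤ (Z + Y) * φ a := mul_le_mul_of_nonneg_right ha (hnn a ha0)
  rw [div_mul_eq_mul_div, le_div_iff₀ hZ]
  linarith

/-- Deterministic inequality for the radial profile `φ` of a joint nonlinearity:
if `φ` is nonnegative and nonincreasing on `(0,∞)` with `a ↦ a·φ(a)` nondecreasing there,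
then for `‖z‖ > ‖y‖`,
`|φ(‖y+z‖) − φ(‖y−z‖)| ≤ (‖y‖/‖z‖)(φ(‖y+z‖) + φ(‖y−z‖))`. -/
theorem stmt4 (d : ℕ) (φ : ℝ → ℝ)
    (hnn : ∀ a : ℝ, 0 < a → 0 ≤ φ a)
    (hanti : AntitoneOn φ (Set.Ioi 0))
    (hmono : MonotoneOn (fun a => a * φ a) (Set.Ioi 0))
    (y z : EuclideanSpace ℝ (Fin d)) (h : ‖y‖ < ‖z‖) :
    |φ ‖y + z‖ - φ ‖y - z‖| ≤ (‖y‖ / ‖z‖) * (φ ‖y + z‖ + φ ‖y - z‖) := by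
  have hZ : 0 < ‖z‖ := (norm_nonneg y).trans_lt h
  have hadd_le : ‖y + z‖ ≤ ‖z‖ + ‖y‖ := by linarith [norm_add_le y z]
  have hsub_le : ‖y - z‖ ≤ ‖z‖ + ‖y‖ := by linarith [norm_sub_le y z]
  have hle_add : ‖z‖ - ‖y‖ ≤ ‖y + z‖ := by
    simpa [add_comm] using norm_sub_norm_le z (-y)
  have hle_sub : ‖z‖ - ‖y‖ ≤ ‖y - z‖ := by
    simpa [norm_sub_rev] using norm_sub_norm_le z y
  have hadd_pos : 0 < ‖y + z‖ := by linarith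
  have hsub_pos : 0 < ‖y - z‖ := by linarith
  rcases le_total ‖y - z‖ ‖y + z‖ with hle | hle
  · rw [abs_sub_comm, abs_of_nonneg (sub_nonneg.2 (hanti hsub_pos hadd_pos hle))]
    exact sub_le_div_mul_add_of_monotoneOn_mul hnn hmono hZ h hle_sub hle hadd_le
  · rw [abs_of_nonneg (sub_nonneg.2 (hanti hadd_pos hsub_pos hle)), add_comm (φ ‖y + z‖)]
    exact sub_le_div_mul_add_of_monotoneOn_mul hnn hmono hZ h hle_add hle hsub_le
end

section
/- Let φ : (0,∞) → ℝ be nonnegative and nonincreasing, with a ↦ a·φ(a) nondecreasing on (0,∞). Let y, z ∈ ℝ^d with y ≠ 0, z ≠ 0, and 0 ≤ ⟨z, y⟩ ≤ ‖z‖·‖y‖/2. Then (‖y‖² + ⟨z,y⟩)·φ(‖y+z‖) + (‖y‖² − ⟨z,y⟩)·φ(‖y−z‖) ≥ (1/2)·‖y‖²·(φ(‖y+z‖) + φ(‖y−z‖)). -/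
open RealInnerProductSpace

/-- If `a ↦ a * φ a` is monotone on the positive reals, then the relative
variation of `φ` between `m ≤ p` is at most the relative variation of the identity. -/
theorem sub_mul_add_le_of_monotoneOn {φ : ℝ → ℝ}
    (hmono : MonotoneOn (fun a => a * φ a) (Set.Ioi 0)) {m p : ℝ} (hm : 0 < m) (hmp : m ≤ p) :
    (φ m - φ p) * (p + m) ≤ (p - m) * (φ p + φ m) := by
  have h : m * φ m ≤ p * φ p := hmono hm (hm.trans_le hmp) hmp
  linarith

/-- Key deterministic inequality `M₂(y,z) ≥ ½‖y‖²[φ(‖y+z‖)+φ(‖y−z‖)]` on the cone of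
directions `z` whose cosine with `y` lies in `[0, 1/2]`. -/
theorem stmt5 (d : ℕ) (φ : ℝ → ℝ)
    (hnn : ∀ a : ℝ, 0 < a → 0 ≤ φ a)
    (hanti : AntitoneOn φ (Set.Ioi 0))
    (hmono : MonotoneOn (fun a => a * φ a) (Set.Ioi 0))
    (y z : EuclideanSpace ℝ (Fin d)) (hy : y ≠ 0) (hz : z ≠ 0)
    (h1 : 0 ≤ ⟪z, y⟫) (h2 : ⟪z, y⟫ ≤ ‖z‖ * ‖y‖ / 2) :
    (1 / 2) * ‖y‖ ^ 2 * (φ ‖y + z‖ + φ ‖y - z‖) ≤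
      (‖y‖ ^ 2 + ⟪z, y⟫) * φ ‖y + z‖ + (‖y‖ ^ 2 - ⟪z, y⟫) * φ ‖y - z‖ := by
  have hy_pos : 0 < ‖y‖ := norm_pos_iff.mpr hy
  have hadd := norm_add_sq_real z y
  have hsub := norm_sub_sq_real z y
  rw [add_comm z y] at hadd
  rw [norm_sub_rev z y] at hsub
  have hm : 0 < ‖y - z‖ := by
    rw [norm_pos_iff, sub_ne_zero]
    rintro rfl
    rw [real_inner_self_eq_norm_sq] at h2
    nlinarith
  have hmp : ‖y - z‖ ≤ ‖y + z‖ :=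
    (sq_le_sq₀ (norm_nonneg _) (norm_nonneg _)).mp (by linarith)
  have htri : 2 * ‖z‖ ≤ ‖y + z‖ + ‖y - z‖ := by
    have h := norm_sub_le (y + z) (y - z)
    rwa [show y + z - (y - z) = (2 : ℝ) • z by module, norm_smul, Real.norm_two] at h
  have hvar := sub_mul_add_le_of_monotoneOn hmono hm hmp
  have hsum : 0 ≤ φ ‖y + z‖ + φ ‖y - z‖ := add_nonneg (hnn _ (hm.trans_le hmp)) (hnn _ hm)
  have hz_nonneg := norm_nonneg z
  generalize ‖y + z‖ = p at *
  generalize ‖y - z‖ = m at *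
  generalize ⟪z, y⟫ = s at *
  have hs : 4 * s ^ 2 ≤ (p + m) ^ 2 * (‖y‖ ^ 2 / 4) := calc
    4 * s ^ 2 ≤ 4 * (‖z‖ * ‖y‖ / 2) ^ 2 := by gcongr
    _ = (2 * ‖z‖) ^ 2 * (‖y‖ ^ 2 / 4) := by ring
    _ ≤ (p + m) ^ 2 * (‖y‖ ^ 2 / 4) := by gcongr
  have hpm : 0 < p + m := by linarith
  have hmain : (p + m) ^ 2 * (s * (φ m - φ p)) ≤
      (p + m) ^ 2 * (‖y‖ ^ 2 / 4 * (φ p + φ m)) := calc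
    (p + m) ^ 2 * (s * (φ m - φ p)) = (p + m) * s * ((φ m - φ p) * (p + m)) := by ring
    _ ≤ (p + m) * s * ((p - m) * (φ p + φ m)) := by gcongr
    _ = s * (p ^ 2 - m ^ 2) * (φ p + φ m) := by ring
    _ = 4 * s ^ 2 * (φ p + φ m) := by rw [hadd, hsub]; ring
    _ ≤ (p + m) ^ 2 * (‖y‖ ^ 2 / 4) * (φ p + φ m) := by gcongr
    _ = (p + m) ^ 2 * (‖y‖ ^ 2 / 4 * (φ p + φ m)) := by ring
  have hle := le_of_mul_le_mul_left hmain (by positivity)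
  have hnonneg : 0 ≤ ‖y‖ ^ 2 / 4 * (φ p + φ m) := by positivity
  linarith
end

section
/- Let k ≥ 1 and let z¹, …, z^k : Ω → ℝ^d be integrable random vectors such that E[z^s | σ(z¹,…,z^{s−1})] = 0 almost surely for each s (with the convention that the condition for s = 1 is E[z¹] = 0). Then for every p ∈ [1, 2], E‖ Σ_{s=1}^k z^s ‖ ≤ 2√2 · E[ ( Σ_{s=1}^k ‖z^s‖^p )^{1/p} ]. -/
open MeasureTheory

/-- The radial (nearest point) projection onto the closed unit ball. -/
noncomputable def ballProj {E : Type*} [NormedAddCommGroup E] [NormedSpace ℝ E] (x : E) : E :=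
  (max 1 ‖x‖)⁻¹ • x

/-- The AdaGrad-norm iterates of projected online gradient ascent on the unit ball for the
linear rewards `x 0, x 1, …`. -/
noncomputable def adaGrad {E : Type*} [NormedAddCommGroup E] [NormedSpace ℝ E] (x : ℕ → E) :
    ℕ → E
  | 0 => 0
  | n + 1 => ballProj (adaGrad x n + (√2 / √(∑ i ∈ Finset.range (n + 1), ‖x i‖ ^ 2)) • x n)

section Deterministic

variable {E : Type*} [NormedAddCommGroup E]

lemma norm_ballProj_le [NormedSpace ℝ E] (x : E) : ‖ballProj x‖ ≤ 1 := by
  have h : 0 < max 1 ‖x‖ := by positivity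
  rw [ballProj, norm_smul, norm_inv, Real.norm_of_nonneg h.le, inv_mul_le_one₀ h]
  exact le_max_right _ _

lemma continuous_ballProj [NormedSpace ℝ E] : Continuous (ballProj : E → E) := by
  unfold ballProj
  refine Continuous.smul (Continuous.inv₀ (by fun_prop) fun x => ?_) continuous_id
  positivity

lemma norm_adaGrad_le [NormedSpace ℝ E] (x : ℕ → E) (n : ℕ) : ‖adaGrad x n‖ ≤ 1 := by
  cases n with
  | zero => simp [adaGrad]
  | succ n => exact norm_ballProj_le _

lemma norm_ballProj_sub_sq_le [InnerProductSpace ℝ E] (x u : E) (hu : ‖u‖ ≤ 1) :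
    ‖ballProj x - u‖ ^ 2 ≤ ‖x - u‖ ^ 2 := by
  rcases le_total ‖x‖ 1 with h | h
  · simp [ballProj, max_eq_left h]
  · have hx : 0 < ‖x‖ := by linarith
    have hin : inner ℝ x u ≤ ‖x‖ :=
      (real_inner_le_norm x u).trans (mul_le_of_le_one_right hx.le hu)
    rw [ballProj, max_eq_right h, norm_sub_sq_real, norm_sub_sq_real, real_inner_smul_left,
      norm_smul, norm_inv, norm_norm, inv_mul_cancel₀ hx.ne']
    have hr : 0 ≤ 1 - ‖x‖⁻¹ := sub_nonneg.2 (inv_le_one_of_one_le₀ h)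
    have h1 : ‖x‖⁻¹ * ‖x‖ = 1 := inv_mul_cancel₀ hx.ne'
    nlinarith [mul_le_mul_of_nonneg_left hin hr]

lemma inner_sub_adaGrad_sum_le_potential [InnerProductSpace ℝ E] (x : ℕ → E) (u : E)
    (hu : ‖u‖ ≤ 1) (n : ℕ) :
    ∑ i ∈ Finset.range n, inner ℝ (u - adaGrad x i) (x i) ≤
      (√2 + (4 - ‖adaGrad x n - u‖ ^ 2) / (2 * √2)) *
        √(∑ i ∈ Finset.range n, ‖x i‖ ^ 2) := by
  induction n with
  | zero => simp
  | succ n ih =>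
    rw [Finset.sum_range_succ]
    have hV : 0 ≤ ∑ i ∈ Finset.range n, ‖x i‖ ^ 2 := by positivity
    have hV' : 0 ≤ ∑ i ∈ Finset.range (n + 1), ‖x i‖ ^ 2 := by positivity
    have hVV := Finset.sum_range_succ (fun i => ‖x i‖ ^ 2) n
    have hproj := norm_ballProj_sub_sq_le
      (adaGrad x n + (√2 / √(∑ i ∈ Finset.range (n + 1), ‖x i‖ ^ 2)) • x n) u hu
    rw [show ballProj (adaGrad x n + (√2 / √(∑ i ∈ Finset.range (n + 1), ‖x i‖ ^ 2)) • x n)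
      = adaGrad x (n + 1) from rfl, add_sub_right_comm, norm_add_sq_real,
      real_inner_smul_right, norm_smul, mul_pow] at hproj
    have hy := Real.sqrt_nonneg (∑ i ∈ Finset.range n, ‖x i‖ ^ 2)
    have hy' := Real.sqrt_nonneg (∑ i ∈ Finset.range (n + 1), ‖x i‖ ^ 2)
    have hsq := Real.sq_sqrt hV
    have hsq' := Real.sq_sqrt hV'
    replace hsq' := hsq'.trans (hVV.trans (congrArg (· + ‖x n‖ ^ 2) hsq.symm))
    set y := √(∑ i ∈ Finset.range n, ‖x i‖ ^ 2)
    set y' := √(∑ i ∈ Finset.range (n + 1), ‖x i‖ ^ 2)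
    have hb : ‖adaGrad x n - u‖ ^ 2 ≤ 4 := by
      have h2 : ‖adaGrad x n - u‖ ≤ 2 := by
        linarith [norm_sub_le (adaGrad x n) u, norm_adaGrad_le x n]
      nlinarith [norm_nonneg (adaGrad x n - u)]
    have hinner : inner ℝ (u - adaGrad x n) (x n) = -inner ℝ (adaGrad x n - u) (x n) := by
      rw [← inner_neg_left, neg_sub]
    rw [hinner]
    set I := inner ℝ (adaGrad x n - u) (x n) with hI
    have hc : 0 < √2 := by positivity
    have hc2 : √2 ^ 2 = 2 := Real.sq_sqrt (by norm_num)
    rcases hy'.eq_or_lt with h0 | hpos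
    · have hz : x n = 0 := by
        rw [← norm_eq_zero, ← sq_eq_zero_iff]
        nlinarith [sq_nonneg ‖x n‖]
      have hy0 : y = 0 := by
        rw [← sq_eq_zero_iff]
        nlinarith [sq_nonneg ‖x n‖]
      have hI0 : I = 0 := by rw [hI, hz, inner_zero_right]
      rw [hy0] at ih
      rw [← h0, hI0]
      simpa using ih
    · have hyy : y ≤ y' := by
        refine le_of_sq_le_sq ?_ hy'
        nlinarith [sq_nonneg ‖x n‖]
      rw [Real.norm_of_nonneg (by positivity : 0 ≤ √2 / y'), div_pow, hc2] at hproj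
      set a := ‖adaGrad x n - u‖ ^ 2
      set b := ‖adaGrad x (n + 1) - u‖ ^ 2
      set q := ‖x n‖ ^ 2
      have hproj' : b * y' ≤ a * y' + 2 * √2 * I + 2 * (q / y') := by
        have := mul_le_mul_of_nonneg_right hproj hpos.le
        have e : (a + 2 * (√2 / y' * I) + 2 / y' ^ 2 * q) * y'
            = a * y' + 2 * √2 * I + 2 * (q / y') := by
          field_simp
        linarith
      have hq : q / y' ≤ 2 * (y' - y) := by
        rw [div_le_iff₀ hpos]
        nlinarith
      have hmain : (4 - a) * y - 2 * √2 * I + 4 * y ≤ (4 - b) * y' + 4 * y' := by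
        nlinarith [mul_le_mul_of_nonneg_left hyy (sub_nonneg.2 hb)]
      have e1 : ∀ t v : ℝ, (√2 + (4 - t) / (2 * √2)) * v
          = ((4 - t) * v + 4 * v) / (2 * √2) := by
        intro t v
        field_simp
        rw [hc2]
        ring
      rw [e1] at ih ⊢
      have e2 : ((4 - a) * y + 4 * y) / (2 * √2) + -I
          = ((4 - a) * y - 2 * √2 * I + 4 * y) / (2 * √2) := by
        field_simp
        ring
      calc _ ≤ ((4 - a) * y + 4 * y) / (2 * √2) + -I := by linarith
        _ ≤ _ := by rw [e2]; gcongr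

lemma norm_sum_le_adaGrad [InnerProductSpace ℝ E] (x : ℕ → E) (n : ℕ) :
    ‖∑ i ∈ Finset.range n, x i‖ ≤
      2 * √2 * √(∑ i ∈ Finset.range n, ‖x i‖ ^ 2) +
        ∑ i ∈ Finset.range n, inner ℝ (adaGrad x i) (x i) := by
  set M := ∑ i ∈ Finset.range n, x i with hM
  have hu : ‖‖M‖⁻¹ • M‖ ≤ 1 := by
    rw [norm_smul, norm_inv, norm_norm]
    exact inv_mul_le_one
  have h := inner_sub_adaGrad_sum_le_potential x (‖M‖⁻¹ • M) hu n
  simp_rw [inner_sub_left] at h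
  rw [Finset.sum_sub_distrib, ← inner_sum, ← hM, real_inner_smul_left,
    real_inner_self_eq_norm_sq] at h
  have e : ‖M‖⁻¹ * ‖M‖ ^ 2 = ‖M‖ := by
    rcases eq_or_ne ‖M‖ 0 with h0 | h0
    · simp [h0]
    · field_simp
  have hc2 : √2 ^ 2 = 2 := Real.sq_sqrt (by norm_num)
  have hcoef : √2 + (4 - ‖adaGrad x n - ‖M‖⁻¹ • M‖ ^ 2) / (2 * √2) ≤ 2 * √2 := by
    have : (4 - ‖adaGrad x n - ‖M‖⁻¹ • M‖ ^ 2) / (2 * √2) ≤ √2 := by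
      rw [div_le_iff₀ (by positivity)]
      nlinarith [sq_nonneg ‖adaGrad x n - ‖M‖⁻¹ • M‖]
    linarith
  have := mul_le_mul_of_nonneg_right hcoef
    (Real.sqrt_nonneg (∑ i ∈ Finset.range n, ‖x i‖ ^ 2))
  linarith

/-- The `ℓ^p` quasi-norm of a finite family is antitone in `p`. -/
lemma rpow_sum_rpow_antitone {ι : Type*} (s : Finset ι) (a : ι → ℝ) (ha : ∀ i ∈ s, 0 ≤ a i)
    {p q : ℝ} (hp : 0 < p) (hpq : p ≤ q) :
    (∑ i ∈ s, a i ^ q) ^ (1 / q) ≤ (∑ i ∈ s, a i ^ p) ^ (1 / p) := by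
  have hq : 0 < q := hp.trans_le hpq
  have hS : 0 ≤ ∑ i ∈ s, a i ^ p := Finset.sum_nonneg fun i hi => Real.rpow_nonneg (ha i hi) _
  set N := (∑ i ∈ s, a i ^ p) ^ (1 / p) with hN
  have hN0 : 0 ≤ N := Real.rpow_nonneg hS _
  have hNp : N ^ p = ∑ i ∈ s, a i ^ p := by
    rw [hN, ← Real.rpow_mul hS, one_div_mul_cancel hp.ne', Real.rpow_one]
  have hle : ∀ i ∈ s, a i ≤ N := fun i hi => by
    rw [← Real.rpow_le_rpow_iff (ha i hi) hN0 hp, hNp]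
    exact Finset.single_le_sum (f := fun i => a i ^ p)
      (fun j hj => Real.rpow_nonneg (ha j hj) _) hi
  have hsum : ∑ i ∈ s, a i ^ q ≤ N ^ q := by
    calc ∑ i ∈ s, a i ^ q = ∑ i ∈ s, a i ^ p * a i ^ (q - p) :=
          Finset.sum_congr rfl fun i hi => by
            rw [← Real.rpow_add_of_nonneg (ha i hi) hp.le (sub_nonneg.2 hpq), add_sub_cancel]
      _ ≤ ∑ i ∈ s, a i ^ p * N ^ (q - p) := Finset.sum_le_sum fun i hi =>
          mul_le_mul_of_nonneg_left
            (Real.rpow_le_rpow (ha i hi) (hle i hi) (sub_nonneg.2 hpq))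
            (Real.rpow_nonneg (ha i hi) _)
      _ = N ^ q := by
          rw [← Finset.sum_mul, ← hNp,
            ← Real.rpow_add_of_nonneg hN0 hp.le (sub_nonneg.2 hpq), add_sub_cancel]
  calc (∑ i ∈ s, a i ^ q) ^ (1 / q) ≤ (N ^ q) ^ (1 / q) :=
        Real.rpow_le_rpow (Finset.sum_nonneg fun i hi => Real.rpow_nonneg (ha i hi) _) hsum
          (by positivity)
    _ = N := by rw [← Real.rpow_mul hN0, mul_one_div_cancel hq.ne', Real.rpow_one]

end Deterministic

section Measure

variable {E Ω : Type*} [NormedAddCommGroup E]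

lemma measurable_adaGrad [NormedSpace ℝ E] [MeasurableSpace E] [BorelSpace E]
    [SecondCountableTopology E] {m : MeasurableSpace Ω} (x : ℕ → Ω → E) (n : ℕ)
    (hx : ∀ i < n, Measurable (x i)) : Measurable fun ω => adaGrad (fun i => x i ω) n := by
  induction n with
  | zero => exact measurable_const
  | succ n ih =>
    have hV : Measurable fun ω => ∑ i ∈ Finset.range (n + 1), ‖x i ω‖ ^ 2 :=
      Finset.measurable_fun_sum _ fun i hi => ((hx i (Finset.mem_range.1 hi)).norm).pow_const 2
    have hn := hx n (Nat.lt_succ_self n)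
    exact continuous_ballProj.measurable.comp
      ((ih fun i hi => hx i (hi.trans n.lt_succ_self)).add ((hV.sqrt.const_div _).smul hn))

variable {m0 : MeasurableSpace Ω} {μ : Measure Ω}

lemma integrable_inner_of_norm_le_one [InnerProductSpace ℝ E] {w x : Ω → E} (hw : AEStronglyMeasurable w μ)
    (hw1 : ∀ ω, ‖w ω‖ ≤ 1) (hx : Integrable x μ) :
    Integrable (fun ω => inner ℝ (w ω) (x ω)) μ :=
  hx.mono (hw.inner hx.1) (.of_forall fun ω =>
    (norm_inner_le_norm _ _).trans (mul_le_of_le_one_left (norm_nonneg _) (hw1 ω)))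

lemma integral_inner_eq_zero_of_condExp_eq_zero [InnerProductSpace ℝ E] [CompleteSpace E]
    {m : MeasurableSpace Ω} (hm : m ≤ m0) [SigmaFinite (μ.trim hm)] {w x : Ω → E} (hw : StronglyMeasurable[m] w)
    (hw1 : ∀ ω, ‖w ω‖ ≤ 1) (hx : Integrable x μ) (h0 : μ[x | m] =ᵐ[μ] 0) :
    ∫ ω, inner ℝ (w ω) (x ω) ∂μ = 0 := by
  have hint := integrable_inner_of_norm_le_one (hw.mono hm).aestronglyMeasurable hw1 hx
  have h : μ[fun ω => inner ℝ (w ω) (x ω) | m] =ᵐ[μ] fun ω => inner ℝ (w ω) (μ[x | m] ω) :=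
    condExp_bilin_of_stronglyMeasurable_left (innerSL ℝ) hw hint hx
  rw [← integral_condExp hm, integral_congr_ae h]
  refine integral_eq_zero_of_ae ?_
  filter_upwards [h0] with ω hω
  simp [hω]

lemma integrable_rpow_sum_norm_rpow [MeasurableSpace E] [BorelSpace E] {ι : Type*}
    (s : Finset ι) {x : ι → Ω → E}
    (hmeas : ∀ i ∈ s, Measurable (x i)) (hint : ∀ i ∈ s, Integrable (x i) μ) {p : ℝ}
    (hp : 1 ≤ p) : Integrable (fun ω => (∑ i ∈ s, ‖x i ω‖ ^ p) ^ (1 / p)) μ := by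
  refine (integrable_finsetSum s fun i hi => (hint i hi).norm).mono'
    ((Finset.measurable_fun_sum s fun i hi =>
      (hmeas i hi).norm.pow_const p).pow_const _).aestronglyMeasurable
    (.of_forall fun ω => ?_)
  rw [Real.norm_of_nonneg (by positivity)]
  simpa using rpow_sum_rpow_antitone s (fun i => ‖x i ω‖) (fun i _ => norm_nonneg _)
    one_pos hp

end Measure

/-- Moment inequality for martingale difference sequences in `ℝ^d`: if each `z^s` is
conditionally centered given `σ(z¹, …, z^{s−1})` (with the `s = 1` condition being
`E[z¹] = 0`, via the trivial σ-algebra), then for every `p ∈ [1,2]`,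
`E‖Σ_{s=1}^k z^s‖ ≤ 2√2 · E[(Σ_{s=1}^k ‖z^s‖^p)^{1/p}]`. -/
theorem stmt14 (d k : ℕ) (hk : 1 ≤ k)
    {Ω : Type*} {m0 : MeasurableSpace Ω} (μ : Measure Ω) [IsProbabilityMeasure μ]
    (z : ℕ → Ω → EuclideanSpace ℝ (Fin d))
    (hmeas : ∀ s, Measurable (z s))
    (hint : ∀ s, Integrable (z s) μ)
    (hmart : ∀ s, 1 ≤ s → s ≤ k →
      μ[z s | ⨆ r ∈ Finset.Ico 1 s, MeasurableSpace.comap (z r) inferInstance] =ᵐ[μ] 0)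
    (p : ℝ) (hp1 : 1 ≤ p) (hp2 : p ≤ 2) :
    (∫ ω, ‖∑ s ∈ Finset.Icc 1 k, z s ω‖ ∂μ) ≤
      2 * Real.sqrt 2 *
        ∫ ω, (∑ s ∈ Finset.Icc 1 k, ‖z s ω‖ ^ p) ^ (1 / p) ∂μ := by
  have shift : ∀ {M : Type} [AddCommMonoid M] (f : ℕ → M),
      ∑ s ∈ Finset.Icc 1 k, f s = ∑ i ∈ Finset.range k, f (i + 1) := by
    intro M _ f
    rw [Finset.range_eq_Ico, Finset.sum_Ico_add' f 0 k 1, Finset.Ico_add_one_right_eq_Icc]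
  simp_rw [shift]
  set w : ℕ → Ω → EuclideanSpace ℝ (Fin d) :=
    fun i ω => adaGrad (fun j => z (j + 1) ω) i
  have hw1 : ∀ i ω, ‖w i ω‖ ≤ 1 := fun i ω => norm_adaGrad_le _ i
  have hwint : ∀ i, Integrable (fun ω => inner ℝ (w i ω) (z (i + 1) ω)) μ := fun i =>
    integrable_inner_of_norm_le_one
      (measurable_adaGrad (fun j => z (j + 1)) i fun j _ => hmeas _).aestronglyMeasurable
      (hw1 i) (hint _)
  have hw0 : ∀ i ∈ Finset.range k, ∫ ω, inner ℝ (w i ω) (z (i + 1) ω) ∂μ = 0 := by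
    intro i hi
    refine integral_inner_eq_zero_of_condExp_eq_zero
      (iSup₂_le fun r _ => (hmeas r).comap_le) ?_ (hw1 i) (hint _)
      (hmart (i + 1) (by omega) (Finset.mem_range.1 hi))
    refine Measurable.stronglyMeasurable
      (measurable_adaGrad (fun j => z (j + 1)) i fun j hj => ?_)
    refine (comap_measurable (z (j + 1))).mono ?_ le_rfl
    exact le_iSup₂_of_le (f := fun r (_ : r ∈ Finset.Ico 1 (i + 1)) =>
      MeasurableSpace.comap (z r) inferInstance) (j + 1)
      (Finset.mem_Ico.2 ⟨by omega, by omega⟩) le_rfl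
  have hpint := integrable_rpow_sum_norm_rpow (μ := μ) (Finset.range k)
    (x := fun i => z (i + 1)) (fun i _ => hmeas _) (fun i _ => hint _) hp1
  calc ∫ ω, ‖∑ i ∈ Finset.range k, z (i + 1) ω‖ ∂μ
      ≤ ∫ ω, (2 * √2 * (∑ i ∈ Finset.range k, ‖z (i + 1) ω‖ ^ p) ^ (1 / p) +
          ∑ i ∈ Finset.range k, inner ℝ (w i ω) (z (i + 1) ω)) ∂μ := by
        refine integral_mono (integrable_finsetSum _ fun i _ => hint (i + 1)).norm
          ((hpint.const_mul _).add (integrable_finsetSum _ fun i _ => hwint i)) fun ω => ?_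
        refine (norm_sum_le_adaGrad (fun i => z (i + 1) ω) k).trans ?_
        have h := rpow_sum_rpow_antitone (Finset.range k) (fun i => ‖z (i + 1) ω‖)
          (fun i _ => norm_nonneg _) (by linarith) hp2
        simp only [Real.rpow_two, ← Real.sqrt_eq_rpow] at h
        gcongr
    _ = 2 * √2 * ∫ ω, (∑ i ∈ Finset.range k, ‖z (i + 1) ω‖ ^ p) ^ (1 / p) ∂μ := by
        rw [integral_add (hpint.const_mul _) (integrable_finsetSum _ fun i _ => hwint i),
          integral_const_mul, integral_finsetSum _ fun i _ => hwint i,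
          Finset.sum_eq_zero hw0, add_zero]
end
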